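/- Let R be a commutative ring and I an ideal of R. If A, B ∈ GL₂(R) are invertible 2×2 matrices each of which is congruent to the identity matrix entrywise modulo I, then the commutator A·B·A⁻¹·B⁻¹ is congruent to the identity matrix entrywise modulo I². -/

import Mathlib

open Matrix

theorem Matrix.mul_apply_mem_mul {l m n R : Type*} [Fintype m] [CommRing R] {I J : Ideal R}
    {M : Matrix l m R} {N : Matrix m n R} (hM : ∀ i j, M i j ∈ I) (hN : ∀ i j, N i j ∈ J) (i : l)
    (j : n) : (M * N) i j ∈ I * J := by
  rw [Matrix.mul_apply]
  exact Ideal.sum_mem _ fun k _ => Ideal.mul_mem_mul (hM i k) (hN k j)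

/-- `A B A⁻¹ B⁻¹ - 1 = ((A - 1) (B - 1) - (B - 1) (A - 1)) A⁻¹ B⁻¹`. -/
theorem Units.val_commutator_sub_one {S : Type*} [Ring S] (a b : Sˣ) :
    ((a * b * a⁻¹ * b⁻¹ : Sˣ) : S) - 1 =
      (((a : S) - 1) * (b - 1) - (b - 1) * (a - 1)) * ((a⁻¹ * b⁻¹ : Sˣ) : S) := by
  have h : ((a : S) - 1) * (b - 1) - (b - 1) * (a - 1) = a * b - b * a := by noncomm_ring
  rw [h, sub_mul]
  simp [mul_assoc]

/-- If `A, B ∈ GL₂(R)` are both congruent to the identity matrix entrywise modulo an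
ideal `I`, then the commutator `A·B·A⁻¹·B⁻¹` is congruent to the identity matrix
entrywise modulo `I²`. -/
theorem commutator_congruent_one_mod_sq
    (R : Type*) [CommRing R] (I : Ideal R)
    (A B : GL (Fin 2) R)
    (hA : ∀ i j, ((A : Matrix (Fin 2) (Fin 2) R) - 1) i j ∈ I)
    (hB : ∀ i j, ((B : Matrix (Fin 2) (Fin 2) R) - 1) i j ∈ I) :
    ∀ i j, (((A * B * A⁻¹ * B⁻¹ : GL (Fin 2) R) : Matrix (Fin 2) (Fin 2) R) - 1) i j ∈ I ^ 2 := by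
  intro i j
  rw [Units.val_commutator_sub_one, ← Ideal.mul_top (I ^ 2)]
  refine Matrix.mul_apply_mem_mul (fun i j => ?_) (fun _ _ => Submodule.mem_top) i j
  rw [sq]
  exact sub_mem (Matrix.mul_apply_mem_mul hA hB i j) (Matrix.mul_apply_mem_mul hB hA i j)
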